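/- The maximum cardinality c_{4,3} of a line-free subset of [3]^4 equals 52. -/

import Mathlib

def LineFree {n k : ℕ} (A : Finset (Fin n → Fin k)) : Prop :=
  ¬ ∃ w : Fin n → Option (Fin k), (∃ j, w j = none) ∧
      ∀ i : Fin k, (fun j => (w j).getD i) ∈ A

/-- Line-freeness of a two-dimensional 0/1 pattern. -/
def LF2 (h : Fin 3 → Fin 3 → Bool) : Prop :=
  (∀ a, ¬ (h a 0 = true ∧ h a 1 = true ∧ h a 2 = true)) ∧
  (∀ a, ¬ (h 0 a = true ∧ h 1 a = true ∧ h 2 a = true)) ∧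
  ¬ (h 0 0 = true ∧ h 1 1 = true ∧ h 2 2 = true)

/-- Number of points of a two-dimensional pattern. -/
def S2 (h : Fin 3 → Fin 3 → Bool) : ℕ := ∑ a, ∑ b, (h a b).toNat

/-- The pattern with given nine entries. -/
def mk (a b c d e f g h i : Bool) : Fin 3 → Fin 3 → Bool :=
  ![![a, b, c], ![d, e, f], ![g, h, i]]

theorem eq_mk (h : Fin 3 → Fin 3 → Bool) :
    h = mk (h 0 0) (h 0 1) (h 0 2) (h 1 0) (h 1 1) (h 1 2) (h 2 0) (h 2 1) (h 2 2) := by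
  funext a b
  fin_cases a <;> fin_cases b <;> rfl

/-- The four six-point line-free patterns. -/
def G0 := mk false true true true false true true true false
def G1 := mk true false true false true true true true false
def G2 := mk false true true true true false true false true
def G3 := mk true true false true false true false true true

set_option synthInstance.maxHeartbeats 400000 in
set_option synthInstance.maxSize 4000 in
set_option maxRecDepth 100000 in
theorem nine_bools : ∀ a b c d e f g h i : Bool,
    (a && b && c) = false → (d && e && f) = false → (g && h && i) = false →
    (a && d && g) = false → (b && e && h) = false → (c && f && i) = false →
    (a && e && i) = false →
    (a.toNat + b.toNat + c.toNat + (d.toNat + e.toNat + f.toNat)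
      + (g.toNat + h.toNat + i.toNat) ≤ 6) ∧
    (a.toNat + b.toNat + c.toNat + (d.toNat + e.toNat + f.toNat)
      + (g.toNat + h.toNat + i.toNat) = 6 →
      [a, b, c, d, e, f, g, h, i] ∈
        [[false, true, true, true, false, true, true, true, false],
         [true, false, true, false, true, true, true, true, false],
         [false, true, true, true, true, false, true, false, true],
         [true, true, false, true, false, true, false, true, true]]) := by
  decide

theorem dim2 (h : Fin 3 → Fin 3 → Bool) (hl : LF2 h) :
    S2 h ≤ 6 ∧ (S2 h = 6 → h = G0 ∨ h = G1 ∨ h = G2 ∨ h = G3) := by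
  obtain ⟨h1, h2, h3⟩ := hl
  have key := nine_bools (h 0 0) (h 0 1) (h 0 2) (h 1 0) (h 1 1) (h 1 2) (h 2 0) (h 2 1) (h 2 2)
    (by have := h1 0; grind) (by have := h1 1; grind) (by have := h1 2; grind)
    (by have := h2 0; grind) (by have := h2 1; grind) (by have := h2 2; grind)
    (by grind)
  have hs : S2 h = (h 0 0).toNat + (h 0 1).toNat + (h 0 2).toNat
      + ((h 1 0).toNat + (h 1 1).toNat + (h 1 2).toNat)
      + ((h 2 0).toNat + (h 2 1).toNat + (h 2 2).toNat) := by
    simp [S2, Fin.sum_univ_three]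
  rw [hs]
  refine ⟨key.1, fun h6 => ?_⟩
  have := key.2 h6
  simp only [List.mem_cons, List.not_mem_nil, or_false, List.cons.injEq, and_true] at this
  rw [eq_mk h]
  unfold G0 G1 G2 G3
  rcases this with t | t | t | t <;> obtain ⟨t1, t2, t3, t4, t5, t6, t7, t8, t9⟩ := t <;>
    rw [t1, t2, t3, t4, t5, t6, t7, t8, t9] <;> simp

/-- Line-freeness of a three-dimensional pattern. -/
def LF3 (k : Fin 3 → Fin 3 → Fin 3 → Bool) : Prop :=
  (∀ i, LF2 (k i)) ∧
  (∀ a b, ¬ (k 0 a b = true ∧ k 1 a b = true ∧ k 2 a b = true)) ∧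
  (∀ a, ¬ (k 0 0 a = true ∧ k 1 1 a = true ∧ k 2 2 a = true)) ∧
  (∀ a, ¬ (k 0 a 0 = true ∧ k 1 a 1 = true ∧ k 2 a 2 = true)) ∧
  ¬ (k 0 0 0 = true ∧ k 1 1 1 = true ∧ k 2 2 2 = true)

def S3 (k : Fin 3 → Fin 3 → Fin 3 → Bool) : ℕ := ∑ a, S2 (k a)

theorem dim3 (k : Fin 3 → Fin 3 → Fin 3 → Bool) (hl : LF3 k) :
    S3 k ≤ 18 ∧ (S3 k = 18 → k 0 = G2 ∧ k 1 = G3 ∧ k 2 = G1) := by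
  obtain ⟨h1, h2, h3, h4, h5⟩ := hl
  have e0 := dim2 _ (h1 0)
  have e1 := dim2 _ (h1 1)
  have e2 := dim2 _ (h1 2)
  have hs : S3 k = S2 (k 0) + S2 (k 1) + S2 (k 2) := by simp [S3, Fin.sum_univ_three]
  refine ⟨by omega, fun h => ?_⟩
  have f0 := e0.2 (by omega)
  have f1 := e1.2 (by omega)
  have f2 := e2.2 (by omega)
  generalize k 0 = x at *
  generalize k 1 = y at *
  generalize k 2 = z at *
  clear e0 e1 e2 hs h h1
  rcases f0 with rfl | rfl | rfl | rfl <;> rcases f1 with rfl | rfl | rfl | rfl <;>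
    rcases f2 with rfl | rfl | rfl | rfl <;>
    first
    | exact ⟨rfl, rfl, rfl⟩
    | (exfalso; revert h2; decide)
    | (exfalso; revert h3; decide)
    | (exfalso; revert h4; decide)
    | (exfalso; revert h5; decide)

theorem S3_expand (k : Fin 3 → Fin 3 → Fin 3 → Bool) :
    S3 k = ∑ a, ∑ b, ∑ c, (k a b c).toNat := rfl

/-- If two slices are both of size 18, they agree. -/
theorem slices_eq {k l : Fin 3 → Fin 3 → Fin 3 → Bool} (hk : LF3 k) (hl : LF3 l)
    (h1 : S3 k = 18) (h2 : S3 l = 18) : k = l := by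
  obtain ⟨a, b, c⟩ := (dim3 k hk).2 h1
  obtain ⟨a', b', c'⟩ := (dim3 l hl).2 h2
  funext i
  fin_cases i
  · exact a.trans a'.symm
  · exact b.trans b'.symm
  · exact c.trans c'.symm

/-- Disjoint patterns have at most 27 points in total. -/
theorem disj_bound {k l : Fin 3 → Fin 3 → Fin 3 → Bool}
    (h : ∀ a b c, ¬ (k a b c = true ∧ l a b c = true)) : S3 k + S3 l ≤ 27 := by
  rw [S3_expand, S3_expand]
  simp only [← Finset.sum_add_distrib]
  calc _ ≤ ∑ a : Fin 3, ∑ b : Fin 3, ∑ c : Fin 3, 1 := by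
        refine Finset.sum_le_sum fun a _ => Finset.sum_le_sum fun b _ =>
          Finset.sum_le_sum fun c _ => ?_
        have := h a b c
        cases hk : k a b c <;> cases hl : l a b c <;> simp_all
    _ = 27 := by simp

/-- Abstract upper bound for three line-free slices with no common point. -/
theorem dim4 (x y z : Fin 3 → Fin 3 → Fin 3 → Bool) (hx : LF3 x) (hy : LF3 y) (hz : LF3 z)
    (h : ∀ a b c, ¬ (x a b c = true ∧ y a b c = true ∧ z a b c = true)) :
    S3 x + S3 y + S3 z ≤ 52 := by
  by_contra hc
  have bx := (dim3 x hx).1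
  have bY := (dim3 y hy).1
  have bz := (dim3 z hz).1
  have : (S3 x = 18 ∧ S3 y = 18) ∨ (S3 x = 18 ∧ S3 z = 18) ∨ (S3 y = 18 ∧ S3 z = 18) := by omega
  rcases this with ⟨p, q⟩ | ⟨p, q⟩ | ⟨p, q⟩
  · have e := slices_eq hx hy p q
    subst e
    have := disj_bound (k := x) (l := z) (by grind)
    omega
  · have e := slices_eq hx hz p q
    subst e
    have := disj_bound (k := x) (l := y) (by grind)
    omega
  · have e := slices_eq hy hz p q
    subst e
    have := disj_bound (k := x) (l := y) (by grind)
    omega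

/-- The indicator of a set of words of length four. -/
def ind (A : Finset (Fin 4 → Fin 3)) (a b c d : Fin 3) : Bool := decide (![a, b, c, d] ∈ A)

theorem card_eq (A : Finset (Fin 4 → Fin 3)) :
    A.card = S3 (ind A 0) + S3 (ind A 1) + S3 (ind A 2) := by
  have h1 : A.card = ∑ v : Fin 4 → Fin 3, (decide (v ∈ A)).toNat := by
    simp [Bool.toNat, Bool.cond_decide]
  let e : Fin 3 × Fin 3 × Fin 3 × Fin 3 ≃ (Fin 4 → Fin 3) :=
    { toFun := fun p => ![p.1, p.2.1, p.2.2.1, p.2.2.2]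
      invFun := fun v => (v 0, v 1, v 2, v 3)
      left_inv := fun p => rfl
      right_inv := fun v => by funext i; fin_cases i <;> rfl }
  rw [h1, ← e.sum_comp]
  simp only [Fintype.sum_prod_type]
  rw [Fin.sum_univ_three]
  rfl

theorem no_line {A : Finset (Fin 4 → Fin 3)} (hA : LineFree A) (p q r s : Option (Fin 3))
    (hw : p = none ∨ q = none ∨ r = none ∨ s = none) :
    ¬ (ind A (p.getD 0) (q.getD 0) (r.getD 0) (s.getD 0) = true ∧
       ind A (p.getD 1) (q.getD 1) (r.getD 1) (s.getD 1) = true ∧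
       ind A (p.getD 2) (q.getD 2) (r.getD 2) (s.getD 2) = true) := by
  rintro ⟨h0, h1, h2⟩
  apply hA
  refine ⟨![p, q, r, s], ?_, ?_⟩
  · rcases hw with h | h | h | h
    · exact ⟨0, h⟩
    · exact ⟨1, h⟩
    · exact ⟨2, h⟩
    · exact ⟨3, h⟩
  · have key : ∀ i : Fin 3, (fun j => ((![p, q, r, s] : Fin 4 → Option (Fin 3)) j).getD i)
        = ![p.getD i, q.getD i, r.getD i, s.getD i] := by
      intro i; funext j; fin_cases j <;> rfl
    intro i
    rw [key]
    fin_cases i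
    · exact of_decide_eq_true h0
    · exact of_decide_eq_true h1
    · exact of_decide_eq_true h2

theorem slice_LF3 {A : Finset (Fin 4 → Fin 3)} (hA : LineFree A) (i : Fin 3) :
    LF3 (ind A i) := by
  refine ⟨fun a => ⟨fun b => ?_, fun b => ?_, ?_⟩, fun a b => ?_, fun a => ?_, fun a => ?_, ?_⟩
  · exact no_line hA (some i) (some a) (some b) none (by simp)
  · exact no_line hA (some i) (some a) none (some b) (by simp)
  · exact no_line hA (some i) (some a) none none (by simp)
  · exact no_line hA (some i) none (some a) (some b) (by simp)
  · exact no_line hA (some i) none none (some a) (by simp)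
  · exact no_line hA (some i) none (some a) none (by simp)
  · exact no_line hA (some i) none none none (by simp)

/-- Membership test for the extremal example. -/
def good (a b c d : Fin 3) : Bool :=
  (a.val + b.val + c.val + d.val) % 3 != 1 &&
  (a.val + b.val + c.val + d.val) != 0 && (a.val + b.val + c.val + d.val) != 8

/-- The extremal example. -/
def ex52 : Finset (Fin 4 → Fin 3) :=
  Finset.univ.filter fun v => good (v 0) (v 1) (v 2) (v 3) = true

set_option maxRecDepth 100000 in
theorem good_lines : ∀ p q r s : Option (Fin 3),
    (p = none ∨ q = none ∨ r = none ∨ s = none) →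
    ¬ (∀ i, good (p.getD i) (q.getD i) (r.getD i) (s.getD i) = true) := by
  decide

theorem ex52_lineFree : LineFree ex52 := by
  rintro ⟨w, ⟨j, hj⟩, h⟩
  refine good_lines (w 0) (w 1) (w 2) (w 3) ?_ fun i => ?_
  · fin_cases j
    · exact Or.inl hj
    · exact Or.inr (Or.inl hj)
    · exact Or.inr (Or.inr (Or.inl hj))
    · exact Or.inr (Or.inr (Or.inr hj))
  · exact (Finset.mem_filter.1 (h i)).2

theorem ex52_ind : ind ex52 = good := by
  funext a b c d
  simp [ind, ex52]

set_option maxRecDepth 100000 in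
theorem ex52_card : ex52.card = 52 := by
  rw [card_eq, ex52_ind]
  decide

/-- `c_{4,3} = 52`. -/
theorem c43_eq_fiftytwo :
    IsGreatest {m | ∃ A : Finset (Fin 4 → Fin 3), LineFree A ∧ A.card = m} 52 := by
  refine ⟨⟨ex52, ex52_lineFree, ex52_card⟩, ?_⟩
  rintro m ⟨A, hA, rfl⟩
  rw [card_eq]
  exact dim4 _ _ _ (slice_LF3 hA 0) (slice_LF3 hA 1) (slice_LF3 hA 2)
    fun a b c => no_line hA none (some a) (some b) (some c) (by simp)
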